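/- There exists an entire function G : ℂ → ℂ such that (i) for every complex s with Re(s) > 1, G(s) = sin(πs)·Γ(s)·( h(s) − ζ(s+1) + (Γ′(s)/Γ(s))·ζ(s) + ζ′(s) ), where h(s) = Σ_{n=1}^∞ H_n n^{−s}; and (ii) for every integer n ≥ 1, G(1 − n) = π·A_n, where A_n = Σ_{k=1}^{n} (B(k)/(k!·k))·(B(n−k)/(n−k)!) and B(m) are the Bernoulli numbers with B(1) = +1/2. -/

import Mathlib

open Complex Finset

/-- The convolution `A_n = Σ_{k+j=n, k≥1, j≥0} (B(k)/(k!·k))·(B(j)/j!)` where `B` are the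
Bernoulli numbers with the convention `B(1) = +1/2` (Mathlib's `bernoulli'`). -/
noncomputable def convA (n : ℕ) : ℂ :=
  ∑ k ∈ Finset.Icc 1 n,
    ((bernoulli' k : ℚ) : ℂ) / ((Nat.factorial k : ℂ) * k) *
      (((bernoulli' (n - k) : ℚ) : ℂ) / (Nat.factorial (n - k) : ℂ))

noncomputable def bb (k : ℕ) : ℝ := ((bernoulli k : ℚ) : ℝ) / (k.factorial : ℝ)

noncomputable def ee (k : ℕ) : ℝ := if k = 0 then 0 else 1 / (k.factorial : ℝ)

lemma bb_conv (n : ℕ) :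
    ∑ p ∈ Finset.HasAntidiagonal.antidiagonal n, bb p.1 * ee p.2 = if n = 1 then 1 else 0 := by
  have h := congrArg (PowerSeries.coeff n) (bernoulliPowerSeries_mul_exp_sub_one ℝ)
  rw [PowerSeries.coeff_mul, PowerSeries.coeff_X] at h
  rw [← h]
  refine Finset.sum_congr rfl fun p _ => ?_
  congr 1
  · simp [bb, bernoulliPowerSeries]
  · simp only [ee, map_sub, PowerSeries.coeff_exp, PowerSeries.coeff_one]
    split_ifs with h0
    · simp [h0]
    · simp

lemma sum_ee_le (n : ℕ) : ∑ k ∈ Finset.range n, ee (n + 1 - k) ≤ 1 - (1/2)^n := by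
  have h1 : ∑ k ∈ Finset.range n, ee (n + 1 - k) = ∑ k ∈ Finset.range n, ee (k + 2) := by
    rw [← Finset.sum_range_reflect]
    refine Finset.sum_congr rfl fun k hk => ?_
    congr 1
    have := Finset.mem_range.1 hk
    omega
  rw [h1]
  have h2 : ∀ k : ℕ, ee (k + 2) ≤ (1/2)^(k+1) := by
    intro k
    have h3 : 2 ^ (k+1) ≤ (k+2).factorial := by
      induction k with
      | zero => decide
      | succ k ih =>
        rw [pow_succ, Nat.factorial_succ (k+2)]
        nlinarith
    have h3' : (2:ℝ) ^ (k+1) ≤ ((k+2).factorial : ℝ) := by exact_mod_cast h3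
    simp only [ee, if_neg (show k + 2 ≠ 0 by omega)]
    rw [div_pow, one_pow]
    exact one_div_le_one_div_of_le (by positivity) h3'
  calc _ ≤ ∑ k ∈ Finset.range n, (1/2:ℝ)^(k+1) := Finset.sum_le_sum fun k _ => h2 k
    _ = 1 - (1/2)^n := by
      induction n with
      | zero => simp
      | succ n ih =>
        rw [Finset.sum_range_succ, ih (by
          rw [← Finset.sum_range_reflect]
          refine Finset.sum_congr rfl fun k hk => ?_
          congr 1
          have := Finset.mem_range.1 hk
          omega)]
        ring

lemma bb_zero : bb 0 = 1 := by simp [bb]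

lemma abs_bb_le (n : ℕ) : |bb n| ≤ 1 := by
  induction n using Nat.strong_induction_on with
  | _ n ih =>
    rcases Nat.eq_zero_or_pos n with h0 | h0
    · subst h0; simp [bb_zero]
    have h := bb_conv (n + 1)
    rw [if_neg (by omega), Finset.Nat.sum_antidiagonal_eq_sum_range_succ (fun i j => bb i * ee j),
      Finset.sum_range_succ, Finset.sum_range_succ] at h
    have e0 : ee (n + 1 - (n + 1)) = 0 := by simp [ee]
    have e1 : ee (n + 1 - n) = 1 := by simp [ee]
    rw [e0, e1] at h
    have hb : bb n = - ∑ k ∈ Finset.range n, bb k * ee (n + 1 - k) := by linarith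
    rw [hb, abs_neg]
    have hee : ∀ m, 0 ≤ ee m := by
      intro m; unfold ee; split_ifs <;> positivity
    calc _ ≤ ∑ k ∈ Finset.range n, |bb k * ee (n + 1 - k)| := Finset.abs_sum_le_sum_abs _ _
      _ ≤ ∑ k ∈ Finset.range n, ee (n + 1 - k) := by
        refine Finset.sum_le_sum fun k hk => ?_
        rw [abs_mul, abs_of_nonneg (hee _)]
        exact mul_le_of_le_one_left (hee _) (ih k (Finset.mem_range.1 hk))
      _ ≤ 1 - (1/2)^n := sum_ee_le n
      _ ≤ 1 := by
        have : (0:ℝ) ≤ (1/2)^n := by positivity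
        linarith

lemma summable_bb {t : ℝ} (ht : |t| < 1) : Summable fun n => ‖bb n * t ^ n‖ := by
  refine Summable.of_nonneg_of_le (fun _ => norm_nonneg _) (fun n => ?_)
    (summable_geometric_of_lt_one (abs_nonneg t) ht)
  rw [norm_mul, norm_pow, Real.norm_eq_abs, Real.norm_eq_abs]
  exact mul_le_of_le_one_left (by positivity) (abs_bb_le n)

lemma hasSum_ee (t : ℝ) : HasSum (fun n => ee n * t ^ n) (Real.exp t - 1) := by
  have h := NormedSpace.expSeries_div_hasSum_exp (𝔸 := ℝ) t
  rw [← Real.exp_eq_exp_ℝ] at h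
  have h2 : HasSum (fun n : ℕ => if n = 0 then (1:ℝ) else 0) 1 := hasSum_ite_eq 0 1
  refine (h.sub h2).congr_fun ?_ 
  intro n
  unfold ee
  split_ifs with h0
  · simp [h0]
  · ring

lemma bb_mul {t : ℝ} (ht : |t| < 1) : (∑' n, bb n * t ^ n) * (Real.exp t - 1) = t := by
  have hee : Summable fun n => ‖ee n * t ^ n‖ := (hasSum_ee t).summable.norm
  rw [← (hasSum_ee t).tsum_eq,
    tsum_mul_tsum_eq_tsum_sum_antidiagonal_of_summable_norm (summable_bb ht) hee]
  have : ∀ n, ∑ p ∈ Finset.HasAntidiagonal.antidiagonal n, (bb p.1 * t ^ p.1) * (ee p.2 * t ^ p.2)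
      = if n = 1 then t else 0 := by
    intro n
    have h1 : ∑ p ∈ Finset.HasAntidiagonal.antidiagonal n, (bb p.1 * t ^ p.1) * (ee p.2 * t ^ p.2)
      = (∑ p ∈ Finset.HasAntidiagonal.antidiagonal n, bb p.1 * ee p.2) * t ^ n := by
      rw [Finset.sum_mul]
      refine Finset.sum_congr rfl fun p hp => ?_
      rw [← Finset.HasAntidiagonal.mem_antidiagonal.1 hp, pow_add]; ring
    rw [h1, bb_conv]
    split_ifs with h
    · simp [h]
    · simp
  simp_rw [this]
  exact tsum_ite_eq 1 _

/-- The logarithm series. -/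
noncomputable def LL (t : ℝ) : ℝ := ∑' n, -(bb (n+1) / ((n+1 : ℕ) : ℝ)) * t ^ (n + 1)

lemma LL_deriv {t : ℝ} (ht : |t| < 1) : HasDerivAt LL (∑' n, -bb (n+1) * t ^ n) t := by
  obtain ⟨r, hr1, hr2⟩ := exists_between ht
  have hr0 : 0 < r := (abs_nonneg t).trans_lt hr1
  unfold LL
  refine hasDerivAt_tsum_of_isPreconnected (t := Metric.ball 0 r) (y₀ := 0)
    (g := fun n z => -(bb (n+1) / ((n+1 : ℕ) : ℝ)) * z ^ (n + 1))
    (g' := fun n z => -bb (n+1) * z ^ n)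
    (summable_geometric_of_lt_one hr0.le hr2) Metric.isOpen_ball
    (convex_ball 0 r).isPreconnected ?_ ?_ (by simpa using hr0) ?_ (by simpa using hr1)
  · intro n y _
    have h := ((hasDerivAt_pow (n+1) y).const_mul (-(bb (n+1) / ((n+1 : ℕ) : ℝ))))
    refine h.congr_deriv ?_
    have : ((n+1:ℕ):ℝ) ≠ 0 := by positivity
    rw [neg_mul, neg_mul, neg_inj, Nat.add_sub_cancel, ← mul_assoc, div_mul_cancel₀ _ this]
  · intro n y hy
    have hy' : |y| < r := by simpa using hy
    rw [norm_mul, norm_pow, norm_neg, Real.norm_eq_abs, Real.norm_eq_abs]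
    calc _ ≤ 1 * |y| ^ n := by gcongr; exact abs_bb_le _
      _ ≤ r ^ n := by rw [one_mul]; gcongr
  · simp [summable_zero]

lemma LL_zero : LL 0 = 0 := by simp [LL]

lemma LL_eq {t : ℝ} (h0 : 0 < t) (h1 : t < 1) :
    LL t = Real.log t - Real.log (1 - Real.exp (-t)) := by
  have hpos : ∀ x : ℝ, 0 < x → 0 < 1 - Real.exp (-x) := fun x hx => by
    have : Real.exp (-x) < 1 := by rw [Real.exp_lt_one_iff]; linarith
    linarith
  -- the function K is constant on (0,1)
  set K : ℝ → ℝ := fun x => LL x - (Real.log x - Real.log (1 - Real.exp (-x))) with hK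
  have hd : ∀ x ∈ Set.Ioo (0:ℝ) 1, HasDerivAt K 0 x := by
    intro x hx
    have hax : |x| < 1 := by rw [abs_of_pos hx.1]; exact hx.2
    have e1 := LL_deriv hax
    have e2 := Real.hasDerivAt_log hx.1.ne'
    have e3 : HasDerivAt (fun x : ℝ => 1 - Real.exp (-x)) (Real.exp (-x)) x := by
      have := ((hasDerivAt_neg x).exp).const_sub 1
      simpa using this
    have e4 := e3.log (hpos x hx.1).ne'
    have := e1.sub (e2.sub e4)
    refine this.congr_deriv ?_
    have m := bb_mul hax
    have s : ∑' n, bb n * x ^ n = 1 - x * ∑' n, -bb (n+1) * x ^ n := by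
      rw [(summable_bb hax).of_norm.tsum_eq_zero_add, bb_zero, ← tsum_mul_left, ]
      rw [sub_eq_add_neg, ← tsum_neg]
      congr 1
      · simp
      · congr 1; ext n; ring
    rw [s] at m
    have hx0 := hx.1.ne'
    have hE : Real.exp x - 1 ≠ 0 := by
      have := Real.add_one_lt_exp hx0
      have := hx.1
      intro h; linarith
    have hp := (hpos x hx.1).ne'
    have hexp : Real.exp x ≠ 0 := (Real.exp_pos x).ne'
    rw [Real.exp_neg] at hp ⊢
    have e5 : (Real.exp x)⁻¹ / (1 - (Real.exp x)⁻¹) = 1 / (Real.exp x - 1) := by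
      rw [div_eq_div_iff hp hE]; field_simp
    rw [e5]
    clear e1 this s
    generalize ∑' n, -bb (n+1) * x ^ n = S at m ⊢
    have : S = (1 - x / (Real.exp x - 1)) / x := by
      rw [eq_div_iff hx0]
      field_simp
      linarith
    rw [this]
    field_simp
    ring
  have hconst : ∀ x ∈ Set.Ioo (0:ℝ) 1, K x = K t := by
    intro x hx
    refine (convex_Ioo (0:ℝ) 1).is_const_of_fderivWithin_eq_zero (𝕜 := ℝ)
      (fun y hy => (hd y hy).differentiableAt.differentiableWithinAt) ?_ hx ⟨h0, h1⟩
    intro y hy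
    have h := (hd y hy).hasFDerivAt.hasFDerivWithinAt (s := Set.Ioo (0:ℝ) 1)
    rw [h.fderivWithin (isOpen_Ioo.uniqueDiffWithinAt hy)]
    ext; simp
  have hlim : Filter.Tendsto K (nhdsWithin 0 (Set.Ioi 0)) (nhds 0) := by
    have c1 : Filter.Tendsto LL (nhdsWithin 0 (Set.Ioi 0)) (nhds 0) := by
      have := (LL_deriv (t := 0) (by simp)).continuousAt.tendsto
      rw [LL_zero] at this
      exact this.mono_left nhdsWithin_le_nhds
    have c2 : Filter.Tendsto (fun x => Real.log x - Real.log (1 - Real.exp (-x)))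
        (nhdsWithin 0 (Set.Ioi 0)) (nhds 0) := by
      refine tendsto_of_tendsto_of_tendsto_of_le_of_le' (g := fun _ => 0) (h := fun x => x)
        tendsto_const_nhds (Filter.tendsto_id.mono_left nhdsWithin_le_nhds) ?_ ?_
      · filter_upwards [self_mem_nhdsWithin] with x hx
        have := Real.add_one_le_exp (-x)
        exact sub_nonneg.2 (Real.log_le_log (hpos x hx) (by linarith))
      · filter_upwards [self_mem_nhdsWithin] with x hx
        have hx' : 0 < x := hx
        have : x * Real.exp (-x) ≤ 1 - Real.exp (-x) := by
          have h := Real.add_one_le_exp x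
          have h2 : Real.exp x * Real.exp (-x) = 1 := by rw [← Real.exp_add]; simp
          nlinarith [Real.exp_pos (-x)]
        have h3 := Real.log_le_log (by positivity) this
        rw [Real.log_mul hx'.ne' (Real.exp_pos _).ne', Real.log_exp] at h3
        linarith
    simpa using c1.sub c2
  have hlim2 : Filter.Tendsto K (nhdsWithin 0 (Set.Ioi 0)) (nhds (K t)) := by
    refine tendsto_const_nhds.congr' ?_
    filter_upwards [Ioo_mem_nhdsGT (zero_lt_one (α := ℝ))] with x hx
    exact (hconst x hx).symm
  have := tendsto_nhds_unique hlim hlim2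
  simp only [hK] at this
  linarith

noncomputable def phi (t : ℝ) : ℝ :=
  (Real.log t - Real.log (1 - Real.exp (-t))) / (Real.exp t - 1)

noncomputable def cc (m : ℕ) : ℝ :=
  ∑ p ∈ Finset.HasAntidiagonal.antidiagonal m, -(bb (p.1 + 1) / ((p.1 + 1 : ℕ) : ℝ)) * bb p.2

lemma abs_cc_le (m : ℕ) : |cc m| ≤ m + 1 := by
  unfold cc
  refine (Finset.abs_sum_le_sum_abs _ _).trans ?_
  calc _ ≤ ∑ p ∈ Finset.HasAntidiagonal.antidiagonal m, (1:ℝ) := by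
        refine Finset.sum_le_sum fun p _ => ?_
        rw [abs_mul, abs_neg, abs_div, Nat.abs_cast]
        have h1 := abs_bb_le (p.1+1)
        have h2 := abs_bb_le p.2
        have h3 : (1:ℝ) ≤ ((p.1+1:ℕ):ℝ) := by simp
        have h4 : |bb (p.1+1)| / ((p.1+1:ℕ):ℝ) ≤ 1 := by
          rw [div_le_one (by positivity)]; linarith
        exact mul_le_one₀ h4 (abs_nonneg _) h2
    _ = m + 1 := by simp

lemma cc_eq (m : ℕ) : ((cc m : ℝ) : ℂ) = (-1) ^ m * convA (m + 1) := by
  unfold cc convA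
  rw [Finset.Nat.sum_antidiagonal_eq_sum_range_succ
    (fun i j => -(bb (i + 1) / ((i + 1 : ℕ) : ℝ)) * bb j),
    ← Finset.Ico_add_one_right_eq_Icc, Finset.sum_Ico_eq_sum_range, Finset.mul_sum]
  push_cast
  refine Finset.sum_congr rfl fun k hk => ?_
  have hk' : k ≤ m := by have := Finset.mem_range.1 hk; omega
  obtain ⟨j, rfl⟩ := Nat.exists_eq_add_of_le hk'
  have e1 : k + j + 1 - (1 + k) = j := by omega
  have e2 : k + j - k = j := by omega
  rw [e1, e2, bernoulli'_eq_bernoulli, bernoulli'_eq_bernoulli, add_comm 1 k]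
  unfold bb
  push_cast
  have e3 : ((-1:ℂ)) ^ (k + j) * (-1) ^ (k + 1) * (-1) ^ j = -1 := by
    rw [← pow_add, ← pow_add]
    exact Odd.neg_one_pow ⟨k + j, by ring⟩
  have : (1 + (k:ℂ)) = k + 1 := add_comm _ _
  have f1 : ((k+1).factorial : ℂ) ≠ 0 := by exact_mod_cast Nat.factorial_ne_zero _
  have f2 : ((j).factorial : ℂ) ≠ 0 := by exact_mod_cast Nat.factorial_ne_zero _
  have f3 : (k:ℂ) + 1 ≠ 0 := by exact_mod_cast Nat.succ_ne_zero k
  simp only [this]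
  calc _ = ((-1:ℂ) ^ (k + j) * (-1) ^ (k + 1) * (-1) ^ j) *
        (((bernoulli (k + 1) : ℚ) : ℂ) / ((k+1).factorial : ℂ) / ((k:ℂ) + 1) *
          (((bernoulli j : ℚ) : ℂ) / (j.factorial : ℂ))) := by rw [e3]; ring
    _ = _ := by field_simp

lemma hasSum_phi {t : ℝ} (h0 : 0 < t) (h1 : t < 1) : HasSum (fun m => cc m * t ^ m) (phi t) := by
  have hat : |t| < 1 := by rwa [abs_of_pos h0]
  have s1 : Summable fun n : ℕ => ‖-(bb (n+1) / ((n+1 : ℕ) : ℝ)) * t ^ n‖ := by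
    refine Summable.of_nonneg_of_le (fun _ => norm_nonneg _) (fun n => ?_)
      (summable_geometric_of_lt_one (abs_nonneg t) hat)
    rw [norm_mul, norm_pow, norm_neg, norm_div, Real.norm_eq_abs, Real.norm_eq_abs, Real.norm_eq_abs]
    refine mul_le_of_le_one_left (by positivity) ?_
    rw [Nat.abs_cast]
    have h3 : (1:ℝ) ≤ ((n+1:ℕ):ℝ) := by simp
    rw [div_le_one (by positivity)]
    exact (abs_bb_le _).trans h3
  have s2 := summable_bb hat
  have hprod := tsum_mul_tsum_eq_tsum_sum_antidiagonal_of_summable_norm s1 s2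
  have hsum := (summable_norm_sum_mul_antidiagonal_of_summable_norm s1 s2).of_norm
  have hterm : (fun n => ∑ p ∈ Finset.HasAntidiagonal.antidiagonal n,
      (-(bb (p.1+1) / ((p.1+1 : ℕ) : ℝ)) * t ^ p.1) * (bb p.2 * t ^ p.2))
      = fun n => cc n * t ^ n := by
    ext n
    unfold cc
    rw [Finset.sum_mul]
    refine Finset.sum_congr rfl fun p hp => ?_
    rw [← Finset.HasAntidiagonal.mem_antidiagonal.1 hp, pow_add]; ring
  rw [hterm] at hprod hsum
  have hL : LL t = (∑' n : ℕ, -(bb (n+1) / ((n+1 : ℕ) : ℝ)) * t ^ n) * t := by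
    unfold LL
    rw [← tsum_mul_right]
    congr 1; ext n; ring
  have hQ := bb_mul hat
  have hE : Real.exp t - 1 ≠ 0 := by
    have := Real.add_one_lt_exp h0.ne'
    intro h; linarith
  have : phi t = ∑' n, cc n * t ^ n := by
    rw [← hprod]
    unfold phi
    rw [← LL_eq h0 h1, hL, div_eq_iff hE, mul_assoc, hQ]
  rw [this]
  exact hsum.hasSum

lemma exp_neg_lt {t : ℝ} (h0 : 0 < t) : 0 < 1 - Real.exp (-t) := by
  have : Real.exp (-t) < 1 := by rw [Real.exp_lt_one_iff]; linarith
  linarith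

lemma phi_nonneg {t : ℝ} (h0 : 0 < t) : 0 ≤ phi t := by
  have := Real.add_one_le_exp (-t)
  have h2 := Real.add_one_le_exp t
  exact div_nonneg (sub_nonneg.2 (Real.log_le_log (exp_neg_lt h0) (by linarith))) (by linarith)

lemma phi_le {t : ℝ} (h0 : 0 < t) : phi t ≤ t / (Real.exp t - 1) := by
  have h2 := Real.add_one_le_exp t
  have : t * Real.exp (-t) ≤ 1 - Real.exp (-t) := by
    have h3 : Real.exp t * Real.exp (-t) = 1 := by rw [← Real.exp_add]; simp
    nlinarith [Real.exp_pos (-t)]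
  have h3 := Real.log_le_log (by positivity) this
  rw [Real.log_mul h0.ne' (Real.exp_pos _).ne', Real.log_exp] at h3
  unfold phi
  exact div_le_div_of_nonneg_right (by linarith) (by linarith)

lemma phi_le_one {t : ℝ} (h0 : 0 < t) : phi t ≤ 1 := by
  refine (phi_le h0).trans ?_
  have h2 := Real.add_one_le_exp t
  rw [div_le_one (by linarith)]; linarith

lemma exp_half_bound {t : ℝ} (h1 : 1 ≤ t) : t / (Real.exp t - 1) ≤ 4 * Real.exp (-(1/2) * t) := by
  have h2 := Real.add_one_le_exp t
  have h3 := Real.add_one_le_exp (1/2*t)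
  have h4 : Real.exp t = Real.exp (1/2*t) * Real.exp (1/2*t) := by rw [← Real.exp_add]; ring_nf
  have h5 : Real.exp (1/2*t) * Real.exp (-(1/2)*t) = 1 := by rw [← Real.exp_add]; ring_nf; simp
  have h6 := Real.exp_pos (-(1/2)*t)
  rw [div_le_iff₀ (by linarith)]
  have h7 : Real.exp t - 1 ≥ Real.exp t / 2 := by linarith
  calc t ≤ 4 * (Real.exp (1/2*t) / 2) := by linarith
    _ = 4 * (Real.exp (1/2*t) * Real.exp (-(1/2)*t) * Real.exp (1/2*t) / 2) := by rw [h5]; ring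
    _ = 4 * Real.exp (-(1/2) * t) * (Real.exp t / 2) := by rw [h4]; ring
    _ ≤ _ := by gcongr

lemma phi_contOn : ContinuousOn phi (Set.Ioi 0) := by
  unfold phi
  refine ContinuousOn.div (ContinuousOn.sub ?_ ?_) (by fun_prop) ?_
  · exact Real.continuousOn_log.mono fun x hx => (ne_of_gt hx : x ≠ 0)
  · exact ContinuousOn.log (by fun_prop) fun x hx => (exp_neg_lt hx).ne'
  · intro x hx
    have hx' : 0 < x := hx
    have h2 := Real.add_one_le_exp x
    linarith

lemma phi_meas : Measurable phi := by
  unfold phi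
  fun_prop

open Asymptotics in
lemma phi_bigO_top : (fun t => (phi t : ℂ)) =O[Filter.atTop] fun t => Real.exp (-(1/2) * t) := by
  refine IsBigO.of_bound 4 ?_
  filter_upwards [Filter.eventually_ge_atTop 1] with t ht
  have h0 : 0 < t := by linarith
  rw [Complex.norm_real, Real.norm_of_nonneg (phi_nonneg h0), Real.norm_of_nonneg (Real.exp_pos _).le]
  exact (phi_le h0).trans (exp_half_bound ht)

open Asymptotics in
lemma phi_bigO_zero : (fun t => (phi t : ℂ)) =O[nhdsWithin 0 (Set.Ioi 0)]
    fun t => t ^ (-(0:ℝ)) := by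
  refine IsBigO.of_bound 1 ?_
  filter_upwards [self_mem_nhdsWithin] with t ht
  rw [Complex.norm_real, Real.norm_of_nonneg (phi_nonneg ht)]
  simpa using phi_le_one ht

lemma phi_locInt : MeasureTheory.LocallyIntegrableOn (fun t => (phi t : ℂ)) (Set.Ioi 0) :=
  ContinuousOn.locallyIntegrableOn (Complex.continuous_ofReal.comp_continuousOn phi_contOn)
    measurableSet_Ioi

lemma phi_mellinConv {s : ℂ} (hs : 0 < s.re) : MellinConvergent (fun t => (phi t : ℂ)) s :=
  mellinConvergent_of_isBigO_rpow_exp (by norm_num) phi_locInt phi_bigO_top phi_bigO_zero hs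

noncomputable def tailFn : ℝ → ℂ := Set.indicator (Set.Ioi (1/2)) (fun t => (phi t : ℂ))

open Asymptotics in
lemma tail_diff : Differentiable ℂ (mellin tailFn) := by
  intro s
  refine mellin_differentiableAt_of_isBigO_rpow_exp (a := 1/2) (b := s.re - 1) (by norm_num)
    ?_ ?_ ?_ (by linarith)
  · refine phi_locInt.mono ?_ ?_
    · exact ((Complex.measurable_ofReal.comp phi_meas).indicator measurableSet_Ioi).aestronglyMeasurable
    · exact Filter.Eventually.of_forall fun t => norm_indicator_le_norm_self _ _
  · refine (IsBigO.of_bound 1 ?_).trans phi_bigO_top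
    refine Filter.Eventually.of_forall fun t => ?_
    rw [one_mul]
    exact norm_indicator_le_norm_self _ _
  · refine IsBigO.of_bound 1 ?_
    filter_upwards [Ioo_mem_nhdsGT (show (0:ℝ) < 1/2 by norm_num)] with t ht
    have : tailFn t = 0 := Set.indicator_of_notMem (fun h => by
      have h' : 1/2 < t := h
      linarith [ht.2]) _
    rw [this, norm_zero]; positivity

lemma mellin_tail (s : ℂ) : mellin tailFn s =
    ∫ t in Set.Ioi (1/2:ℝ), (t:ℂ) ^ (s - 1) • (phi t : ℂ) := by
  unfold mellin tailFn
  have : ∀ t : ℝ, (t:ℂ) ^ (s - 1) • Set.indicator (Set.Ioi (1/2)) (fun t => (phi t : ℂ)) t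
      = Set.indicator (Set.Ioi (1/2:ℝ)) (fun t => (t:ℂ) ^ (s - 1) • (phi t : ℂ)) t := by
    intro t
    by_cases h : t ∈ Set.Ioi (1/2:ℝ)
    · rw [Set.indicator_of_mem h, Set.indicator_of_mem h]
    · rw [Set.indicator_of_notMem h, Set.indicator_of_notMem h, smul_zero]
  simp_rw [this]
  rw [MeasureTheory.setIntegral_indicator measurableSet_Ioi]
  congr 2
  ext t
  simp only [Set.mem_inter_iff, Set.mem_Ioi]
  exact ⟨fun h => h.2, fun h => ⟨by linarith, h⟩⟩

lemma summable_half : Summable fun m : ℕ => ((m:ℝ) + 1) * (1/2) ^ m := by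
  have h1 := summable_pow_mul_geometric_of_norm_lt_one 1 (r := (1/2:ℝ)) (by norm_num)
  have h2 := summable_geometric_of_lt_one (r := (1/2:ℝ)) (by norm_num) (by norm_num)
  refine (h1.add h2).congr fun m => ?_
  ring

lemma head_hasSum {s : ℂ} (hs : 1 < s.re) :
    HasSum (fun m : ℕ => (cc m : ℂ) * ((1/2:ℂ) ^ s * (1/2) ^ m / (s + m)))
      (∫ t in (0:ℝ)..(1/2), (t:ℂ) ^ (s - 1) • (phi t : ℂ)) := by
  have key := intervalIntegral.hasSum_integral_of_dominated_convergence
    (a := (0:ℝ)) (b := 1/2) (μ := MeasureTheory.volume)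
    (F := fun (m:ℕ) (t:ℝ) => (cc m : ℂ) * (t:ℂ) ^ (s + m - 1))
    (f := fun t : ℝ => (t:ℂ) ^ (s - 1) • (phi t : ℂ))
    (fun m _ => ((m:ℝ) + 1) * (1/2) ^ m) ?_ ?_ ?_ ?_ ?_
  · refine key.congr_fun ?_
    intro m
    have hre : (-1:ℝ) < (s + m - 1).re := by
      have : (0:ℝ) ≤ m := by positivity
      simp; linarith
    rw [intervalIntegral.integral_const_mul, integral_cpow (Or.inl hre)]
    have hne : s + m ≠ 0 := by
      intro h
      have := congrArg Complex.re h
      simp at this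
      have : (0:ℝ) ≤ m := by positivity
      linarith
    rw [sub_add_cancel, Complex.ofReal_zero, Complex.zero_cpow hne, sub_zero]
    push_cast
    rw [Complex.cpow_add _ _ (by norm_num), Complex.cpow_natCast]
  · intro m
    exact (by fun_prop : Measurable _).aestronglyMeasurable
  · intro m
    refine Filter.Eventually.of_forall fun t ht => ?_
    rw [Set.uIoc_of_le (by norm_num)] at ht
    have e : (t:ℂ) ^ (s + m - 1) = (t:ℂ) ^ (s - 1) * (t:ℂ) ^ m := by
      rw [← Complex.cpow_natCast, ← Complex.cpow_add _ _ (by exact_mod_cast ht.1.ne')]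
      congr 1; ring
    rw [e, norm_mul, norm_mul, Complex.norm_real, norm_pow, Complex.norm_real,
      Real.norm_of_nonneg ht.1.le, Complex.norm_cpow_eq_rpow_re_of_pos ht.1]
    have h1 : t ^ (s - 1).re ≤ 1 := by
      refine Real.rpow_le_one ht.1.le (by linarith [ht.2]) ?_
      simp; linarith
    have h2 : t ^ m ≤ (1/2) ^ m := pow_le_pow_left₀ ht.1.le ht.2 m
    have h3 : 0 ≤ t ^ m := pow_nonneg ht.1.le m
    have h4 : 0 ≤ t ^ (s - 1).re := Real.rpow_nonneg ht.1.le _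
    refine mul_le_mul (abs_cc_le m) ?_ (by positivity) (by positivity)
    calc _ ≤ 1 * t ^ m := by gcongr
      _ ≤ _ := by linarith
  · exact Filter.Eventually.of_forall fun t _ => summable_half
  · exact intervalIntegrable_const
  · refine Filter.Eventually.of_forall fun t ht => ?_
    rw [Set.uIoc_of_le (by norm_num)] at ht
    have h := hasSum_phi ht.1 (by linarith [ht.2])
    have h' := (Complex.hasSum_ofReal.2 h).mul_left ((t:ℂ) ^ (s - 1))
    refine h'.congr_fun fun m => ?_
    have e : (t:ℂ) ^ (s + m - 1) = (t:ℂ) ^ (s - 1) * (t:ℂ) ^ m := by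
      rw [← Complex.cpow_natCast, ← Complex.cpow_add _ _ (by exact_mod_cast ht.1.ne')]
      congr 1; ring
    rw [e]; push_cast; ring

lemma mellin_phi_split {s : ℂ} (hs : 1 < s.re) : mellin (fun t => (phi t : ℂ)) s =
    (∫ t in (0:ℝ)..(1/2), (t:ℂ) ^ (s - 1) • (phi t : ℂ)) + mellin tailFn s := by
  rw [mellin_tail, intervalIntegral.integral_of_le (by norm_num)]
  have h := phi_mellinConv (s := s) (by linarith)
  unfold MellinConvergent at h
  unfold mellin
  rw [← Set.Ioc_union_Ioi_eq_Ioi (show (0:ℝ) ≤ 1/2 by norm_num)] at h ⊢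
  rw [MeasureTheory.setIntegral_union Set.Ioc_disjoint_Ioi_same measurableSet_Ioi
    (h.mono_set Set.subset_union_left) (h.mono_set Set.subset_union_right)]

noncomputable def ff (t : ℝ) : ℂ := ((1 / (Real.exp t - 1) : ℝ) : ℂ)

noncomputable def FF (t : ℝ) : ℂ := ((-Real.log (1 - Real.exp (-t)) / (Real.exp t - 1) : ℝ) : ℂ)

lemma exp_mul_geom {t : ℝ} (h0 : 0 < t) :
    Real.exp (-t) * (1 - Real.exp (-t))⁻¹ = 1 / (Real.exp t - 1) := by
  have h1 := (exp_neg_lt h0).ne'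
  have h2 := Real.add_one_le_exp t
  have hE : Real.exp t - 1 ≠ 0 := by intro h; linarith
  have h3 : Real.exp t * Real.exp (-t) = 1 := by rw [← Real.exp_add]; simp
  rw [← div_eq_mul_inv, div_eq_div_iff h1 hE]
  linarith

lemma exp_neg_abs {t : ℝ} (h0 : 0 < t) : |Real.exp (-t)| < 1 := by
  rw [abs_of_pos (Real.exp_pos _)]; linarith [exp_neg_lt h0]

lemma exp_term (n : ℕ) (t : ℝ) : Real.exp (-((n:ℝ) + 1) * t) = Real.exp (-t) * Real.exp (-t) ^ n := by
  rw [← Real.exp_nat_mul, ← Real.exp_add]; ring_nf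

lemma hasSum_ff {t : ℝ} (h0 : 0 < t) :
    HasSum (fun n : ℕ => Real.exp (-((n:ℝ) + 1) * t)) (1 / (Real.exp t - 1)) := by
  rw [← exp_mul_geom h0]
  simp_rw [exp_term]
  exact (hasSum_geometric_of_abs_lt_one (exp_neg_abs h0)).mul_left _

lemma hasSum_harm {x : ℝ} (hx : |x| < 1) :
    HasSum (fun n : ℕ => ((harmonic n : ℚ) : ℝ) * x ^ n) (-Real.log (1 - x) * (1 - x)⁻¹) := by
  have h1 := Real.hasSum_pow_div_log_of_abs_lt_one hx
  have h2 := hasSum_geometric_of_abs_lt_one hx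
  have s1 := h1.summable.norm
  have s2 := h2.summable.norm
  have hprod := tsum_mul_tsum_eq_tsum_sum_antidiagonal_of_summable_norm s1 s2
  have hsum := (summable_norm_sum_mul_antidiagonal_of_summable_norm s1 s2).of_norm
  have hterm : (fun n : ℕ => ∑ p ∈ Finset.HasAntidiagonal.antidiagonal n,
      (x ^ (p.1+1) / ((p.1:ℝ)+1)) * (x ^ p.2))
      = fun n : ℕ => ((harmonic (n+1) : ℚ) : ℝ) * x ^ (n+1) := by
    ext n
    rw [harmonic, Rat.cast_sum, Finset.sum_mul,
      ← Finset.Nat.sum_antidiagonal_eq_sum_range_succ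
        (fun i _ => (((((i+1:ℕ):ℚ)⁻¹ : ℚ)) : ℝ) * x ^ (n+1))]
    refine Finset.sum_congr rfl fun p hp => ?_
    rw [← Finset.HasAntidiagonal.mem_antidiagonal.1 hp]
    push_cast
    ring
  rw [hterm] at hprod hsum
  rw [h1.tsum_eq, h2.tsum_eq] at hprod
  rw [hprod]
  have := hsum.hasSum
  rw [← hasSum_nat_add_iff' 1]
  simpa using this

lemma hasSum_FF {t : ℝ} (h0 : 0 < t) :
    HasSum (fun n : ℕ => ((harmonic n : ℚ) : ℝ) * Real.exp (-((n:ℝ) + 1) * t))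
      (-Real.log (1 - Real.exp (-t)) / (Real.exp t - 1)) := by
  have h := (hasSum_harm (exp_neg_abs h0)).mul_left (Real.exp (-t))
  have e : Real.exp (-t) * (-Real.log (1 - Real.exp (-t)) * (1 - Real.exp (-t))⁻¹)
      = -Real.log (1 - Real.exp (-t)) / (Real.exp t - 1) := by
    rw [mul_left_comm, exp_mul_geom h0, mul_one_div]
  rw [e] at h
  refine h.congr_fun fun n => ?_
  rw [exp_term]; ring

lemma summable_harm {σ : ℝ} (hσ : 1 < σ) :
    Summable fun n : ℕ => ((harmonic n : ℚ) : ℝ) / ((n:ℝ) + 1) ^ σ := by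
  set ε := (σ - 1) / 2 with hε
  have hε0 : 0 < ε := by rw [hε]; linarith
  have hs : Summable fun n : ℕ => ((n:ℝ) + 1) ^ (ε - σ) := by
    have := (Real.summable_nat_rpow (p := ε - σ)).2 (by rw [hε]; linarith)
    have := (summable_nat_add_iff 1).2 this
    simpa using this
  refine Summable.of_nonneg_of_le (fun n => ?_) (fun n => ?_) (hs.mul_left (1 + 1/ε))
  · have : (0:ℝ) ≤ ((harmonic n : ℚ) : ℝ) := by
      rcases Nat.eq_zero_or_pos n with h | h
      · simp [h]
      · exact_mod_cast (harmonic_pos h.ne').le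
    positivity
  · have hn : (0:ℝ) < (n:ℝ) + 1 := by positivity
    have h1 : ((harmonic n : ℚ) : ℝ) ≤ 1 + Real.log ((n:ℝ)+1) := by
      refine (harmonic_le_one_add_log n).trans ?_
      rcases Nat.eq_zero_or_pos n with h | h
      · simp [h]
      · have : Real.log n ≤ Real.log ((n:ℝ)+1) :=
          Real.log_le_log (by exact_mod_cast h) (by linarith)
        linarith
    have h2 : Real.log ((n:ℝ)+1) ≤ ((n:ℝ)+1)^ε / ε := Real.log_le_rpow_div hn.le hε0
    have h3 : 1 ≤ ((n:ℝ)+1)^ε := Real.one_le_rpow (by linarith [(Nat.cast_nonneg n : (0:ℝ) ≤ n)]) hε0.le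
    rw [Real.rpow_sub hn, ← mul_div_assoc]
    gcongr
    calc _ ≤ ((n:ℝ)+1)^ε + ((n:ℝ)+1)^ε / ε := by linarith
      _ = _ := by ring

lemma mellin_FF {s : ℂ} (hs : 1 < s.re) :
    HasSum (fun n : ℕ => Complex.Gamma s * ((harmonic n : ℚ) : ℂ) / ((n:ℂ) + 1) ^ s) (mellin FF s) := by
  have h := hasSum_mellin (a := fun n : ℕ => ((harmonic n : ℚ) : ℂ)) (p := fun n : ℕ => (n:ℝ) + 1)
    (F := FF) (s := s) (fun n => Or.inr (by positivity)) (by linarith) ?_ ?_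
  · simpa using h
  · intro t ht
    have := Complex.hasSum_ofReal.2 (hasSum_FF ht)
    unfold FF
    refine this.congr_fun fun n => ?_
    push_cast; rfl
  · refine (summable_harm hs).congr fun n => ?_
    have : (0:ℝ) ≤ ((harmonic n : ℚ) : ℝ) := by
      rcases Nat.eq_zero_or_pos n with h | h
      · simp [h]
      · exact_mod_cast (harmonic_pos h.ne').le
    have e : ((harmonic n : ℚ) : ℂ) = (((harmonic n : ℚ) : ℝ) : ℂ) := by push_cast; rfl
    rw [e, Complex.norm_real, Real.norm_of_nonneg this]

lemma mellin_ff {s : ℂ} (hs : 1 < s.re) : mellin ff s = Complex.Gamma s * riemannZeta s := by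
  have h := hasSum_mellin (a := fun n : ℕ => (1:ℂ)) (p := fun n : ℕ => (n:ℝ) + 1)
    (F := ff) (s := s) (fun n => Or.inr (by positivity)) (by linarith) ?_ ?_
  · rw [zeta_eq_tsum_one_div_nat_add_one_cpow hs, ← tsum_mul_left, ← h.tsum_eq]
    congr 1; ext n
    push_cast; ring
  · intro t ht
    have := Complex.hasSum_ofReal.2 (hasSum_ff ht)
    unfold ff
    refine this.congr_fun fun n => ?_
    push_cast; ring
  · have := (Real.summable_nat_rpow (p := - s.re)).2 (by linarith)
    have := (summable_nat_add_iff 1).2 this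
    refine this.congr fun n => ?_
    rw [Real.rpow_neg (by positivity)]
    simp

open Asymptotics in
lemma ff_deriv {s : ℂ} (hs : 1 < s.re) :
    MellinConvergent (fun t => Real.log t • ff t) s ∧
      HasDerivAt (mellin ff) (mellin (fun t => Real.log t • ff t) s) s := by
  refine mellin_hasDerivAt_of_isBigO_rpow (a := s.re + 1) (b := 1) ?_ ?_ (by linarith) ?_ hs
  · refine ContinuousOn.locallyIntegrableOn ?_ measurableSet_Ioi
    unfold ff
    refine Complex.continuous_ofReal.comp_continuousOn (ContinuousOn.div (by fun_prop) (by fun_prop) ?_)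
    intro x hx
    have hx' : 0 < x := hx
    have h2 := Real.add_one_le_exp x
    linarith
  · have h1 : ff =O[Filter.atTop] fun t => Real.exp (-(1/2) * t) := by
      refine IsBigO.of_bound 4 ?_
      filter_upwards [Filter.eventually_ge_atTop 1] with t ht
      have h2 := Real.add_one_le_exp t
      unfold ff
      rw [Complex.norm_real, Real.norm_of_nonneg (by apply div_nonneg <;> linarith),
        Real.norm_of_nonneg (Real.exp_pos _).le]
      refine le_trans ?_ (exp_half_bound ht)
      exact div_le_div_of_nonneg_right ht (by linarith)
    exact h1.trans (isLittleO_exp_neg_mul_rpow_atTop (by norm_num) _).isBigO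
  · refine IsBigO.of_bound 1 ?_
    filter_upwards [self_mem_nhdsWithin] with t ht
    have ht' : 0 < t := ht
    have h2 := Real.add_one_le_exp t
    unfold ff
    rw [Complex.norm_real, Real.norm_of_nonneg (by apply div_nonneg <;> linarith), one_mul,
      Real.norm_of_nonneg (by positivity), Real.rpow_neg_one, ← one_div]
    exact one_div_le_one_div_of_le ht' (by linarith)

lemma deriv_formula {s : ℂ} (hs : 1 < s.re) : mellin (fun t => Real.log t • ff t) s =
    deriv Complex.Gamma s * riemannZeta s + Complex.Gamma s * deriv riemannZeta s := by
  have h1 := (ff_deriv hs).2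
  have hΓ : DifferentiableAt ℂ Complex.Gamma s := by
    refine Complex.differentiableAt_Gamma s fun m h => ?_
    rw [h] at hs
    simp at hs
    have : (0:ℝ) ≤ m := by positivity
    linarith
  have hζ : DifferentiableAt ℂ riemannZeta s := differentiableAt_riemannZeta (by
    rintro rfl; simp at hs)
  have h2 := hΓ.hasDerivAt.mul hζ.hasDerivAt
  have h3 : mellin ff =ᶠ[nhds s] Complex.Gamma * riemannZeta := by
    filter_upwards [(isOpen_lt continuous_const Complex.continuous_re).mem_nhds hs] with z hz
    exact mellin_ff hz
  exact h1.unique (h2.congr_of_eventuallyEq h3)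

lemma mellin_phi_eq {s : ℂ} (hs : 1 < s.re) : mellin (fun t => (phi t : ℂ)) s =
    Complex.Gamma s *
          ((∑' n : ℕ, ((harmonic (n + 1) : ℚ) : ℂ) * ((n + 1 : ℕ) : ℂ) ^ (-s))
            - riemannZeta (s + 1)
            + (deriv Complex.Gamma s / Complex.Gamma s) * riemannZeta s
            + deriv riemannZeta s) := by
  have hΓ : Complex.Gamma s ≠ 0 := Complex.Gamma_ne_zero_of_re_pos (by linarith)
  have hsub := (hasMellin_sub (phi_mellinConv (s := s) (by linarith)) (ff_deriv hs).1).2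
  have hF : mellin (fun t => (phi t : ℂ) - Real.log t • ff t) s = mellin FF s := by
    unfold mellin
    refine MeasureTheory.setIntegral_congr_fun measurableSet_Ioi fun t ht => ?_
    simp only [phi, ff, FF]
    congr 1
    rw [Complex.real_smul, ← Complex.ofReal_mul, ← Complex.ofReal_sub]
    congr 1
    ring
  rw [hF] at hsub
  have hz : HasSum (fun n : ℕ => 1 / ((n:ℂ) + 1) ^ (s + 1)) (riemannZeta (s + 1)) := by
    have hs' : 1 < (s+1).re := by simp; linarith
    rw [zeta_eq_tsum_one_div_nat_add_one_cpow hs']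
    refine Summable.hasSum ?_
    have := (summable_nat_add_iff 1).2 (Complex.summable_one_div_nat_cpow.2 hs')
    simpa using this
  have hH := ((mellin_FF hs).mul_left (Complex.Gamma s)⁻¹).add hz
  have hT : (∑' n : ℕ, ((harmonic (n + 1) : ℚ) : ℂ) * ((n + 1 : ℕ) : ℂ) ^ (-s)) =
      (Complex.Gamma s)⁻¹ * mellin FF s + riemannZeta (s + 1) := by
    rw [← hH.tsum_eq]
    congr 1; ext n
    have hn : (n:ℂ) + 1 ≠ 0 := by exact_mod_cast Nat.succ_ne_zero n
    have hp : ((n:ℂ)+1) ^ s ≠ 0 := by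
      rw [Ne, Complex.cpow_eq_zero_iff]; tauto
    rw [harmonic_succ, Complex.cpow_neg, Complex.cpow_add _ _ (by push_cast; exact hn), Complex.cpow_one]
    push_cast
    field_simp
  rw [hT, hsub, deriv_formula hs]
  field_simp
  ring

/-- The entire function `sin (π z) / z`. -/
noncomputable def DD : ℂ → ℂ := dslope (fun z : ℂ => Complex.sin (Real.pi * z)) 0

lemma sinpi_hasDeriv (z : ℂ) : HasDerivAt (fun z : ℂ => Complex.sin (Real.pi * z))
    (Complex.cos (Real.pi * z) * Real.pi) z := by
  have h : HasDerivAt (fun z : ℂ => (Real.pi:ℂ) * z) (Real.pi:ℂ) z := by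
    simpa using (hasDerivAt_id z).const_mul (Real.pi : ℂ)
  exact h.csin

lemma DD_zero : DD 0 = Real.pi := by
  unfold DD
  rw [dslope_same, (sinpi_hasDeriv 0).deriv]
  simp

lemma DD_ne {z : ℂ} (hz : z ≠ 0) : DD z = Complex.sin (Real.pi * z) / z := by
  unfold DD
  rw [dslope_of_ne _ hz, slope_def_field]
  simp

lemma DD_diff : Differentiable ℂ DD := by
  have h : DifferentiableOn ℂ (fun z : ℂ => Complex.sin (Real.pi * z)) Set.univ :=
    fun z _ => (sinpi_hasDeriv z).differentiableAt.differentiableWithinAt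
  exact differentiableOn_univ.1 ((Complex.differentiableOn_dslope Filter.univ_mem).2 h)

lemma norm_cos_le (z : ℂ) : ‖Complex.cos z‖ ≤ Real.exp |z.im| := by
  unfold Complex.cos
  rw [norm_div]
  have h1 : ‖Complex.exp (z * I)‖ ≤ Real.exp |z.im| := by
    rw [Complex.norm_exp]
    refine Real.exp_le_exp.2 ?_
    simp [neg_le_abs]
  have h2 : ‖Complex.exp (-z * I)‖ ≤ Real.exp |z.im| := by
    rw [Complex.norm_exp]
    refine Real.exp_le_exp.2 ?_
    simp [le_abs_self]
  have h3 := norm_add_le (Complex.exp (z * I)) (Complex.exp (-z * I))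
  rw [Complex.norm_ofNat]
  linarith

lemma norm_DD_le {z : ℂ} {R : ℝ} (hz : |z.im| ≤ R) :
    ‖DD z‖ ≤ Real.exp (Real.pi * R) * Real.pi := by
  have hR : 0 ≤ R := (abs_nonneg _).trans hz
  have hpi := Real.pi_pos
  rcases eq_or_ne z 0 with rfl | h0
  · rw [DD_zero, Complex.norm_real, Real.norm_of_nonneg hpi.le]
    have : 1 ≤ Real.exp (Real.pi * R) := Real.one_le_exp (by positivity)
    nlinarith
  · have hconv : Convex ℝ {w : ℂ | |w.im| ≤ R} := by
      have : {w : ℂ | |w.im| ≤ R} = Complex.imLm ⁻¹' (Set.Icc (-R) R) := by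
        ext w; simp [abs_le]
      rw [this]
      exact (convex_Icc _ _).linear_preimage _
    have h := hconv.norm_image_sub_le_of_norm_deriv_le (𝕜 := ℂ)
      (f := fun z : ℂ => Complex.sin (Real.pi * z)) (C := Real.exp (Real.pi * R) * Real.pi)
      (x := 0) (y := z) (fun w _ => (sinpi_hasDeriv w).differentiableAt) ?_ (by simpa using hR) hz
    · rw [DD_ne h0, norm_div, div_le_iff₀ (norm_pos_iff.2 h0)]
      simpa using h
    · intro w hw
      have hw' : |w.im| ≤ R := hw
      rw [(sinpi_hasDeriv w).deriv, norm_mul, Complex.norm_real, Real.norm_of_nonneg hpi.le]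
      gcongr
      refine (norm_cos_le _).trans (Real.exp_le_exp.2 ?_)
      simp only [Complex.im_ofReal_mul, abs_mul, abs_of_pos hpi]
      gcongr

noncomputable def SS (s : ℂ) : ℂ := ∑' m : ℕ, convA (m + 1) * (1/2) ^ m * DD (s + m)

lemma norm_convA (m : ℕ) : ‖convA (m + 1)‖ ≤ m + 1 := by
  have h := congrArg norm (cc_eq m)
  rw [norm_mul, norm_pow, norm_neg, norm_one, one_pow, one_mul, Complex.norm_real] at h
  rw [← h]; exact abs_cc_le m

lemma SS_diff : Differentiable ℂ SS := by
  intro s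
  set R := ‖s‖ + 1 with hR
  have h := Complex.differentiableOn_tsum_of_summable_norm (U := Metric.ball 0 R)
    (F := fun (m:ℕ) (s:ℂ) => convA (m + 1) * (1/2) ^ m * DD (s + m))
    (summable_half.mul_right (Real.exp (Real.pi * R) * Real.pi)) ?_ Metric.isOpen_ball ?_
  · exact h.differentiableAt (Metric.isOpen_ball.mem_nhds (by simp [hR]))
  · intro m
    refine Differentiable.differentiableOn ?_
    have := DD_diff
    fun_prop
  · intro m w hw
    have hw' : ‖w‖ < R := by simpa using hw
    rw [norm_mul, norm_mul, norm_pow]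
    have e : ‖(1/2:ℂ)‖ = 1/2 := by simp
    rw [e]
    have h1 := norm_convA m
    have h2 : ‖DD (w + m)‖ ≤ Real.exp (Real.pi * R) * Real.pi := by
      refine norm_DD_le ?_
      simp only [Complex.add_im, Complex.natCast_im, add_zero]
      exact (Complex.abs_im_le_norm w).trans hw'.le
    gcongr

lemma sin_shift (s : ℂ) (m : ℕ) :
    Complex.sin (Real.pi * (s + m)) = (-1) ^ m * Complex.sin (Real.pi * s) := by
  induction m with
  | zero => simp
  | succ m ih =>
    have : (Real.pi:ℂ) * (s + ((m + 1 : ℕ) : ℂ)) = Real.pi * (s + m) + Real.pi := by push_cast; ring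
    rw [this, Complex.sin_add_pi, ih, pow_succ]
    ring

lemma SS_eq {s : ℂ} (hs : 1 < s.re) : (1/2:ℂ) ^ s * SS s = Complex.sin (Real.pi * s) *
    (∫ t in (0:ℝ)..(1/2), (t:ℂ) ^ (s - 1) • (phi t : ℂ)) := by
  rw [← (head_hasSum hs).tsum_eq]
  unfold SS
  rw [← tsum_mul_left, ← tsum_mul_left]
  congr 1; ext m
  have hne : s + m ≠ 0 := by
    intro h
    have := congrArg Complex.re h
    simp at this
    have : (0:ℝ) ≤ m := by positivity
    linarith
  rw [DD_ne hne, sin_shift, cc_eq]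
  ring

lemma sin_int_zero (n : ℕ) : Complex.sin (Real.pi * (1 - (n:ℂ))) = 0 := by
  rw [Complex.sin_eq_zero_iff]
  exact ⟨1 - n, by push_cast; ring⟩

lemma SS_val (n : ℕ) : SS (-(n:ℂ)) = convA (n + 1) * (1/2) ^ n * Real.pi := by
  unfold SS
  rw [tsum_eq_single n]
  · simp [DD_zero]
  · intro m hm
    have hne : -(n:ℂ) + m ≠ 0 := by
      intro h
      apply hm
      have : (m:ℂ) = n := by linear_combination h
      exact_mod_cast this
    rw [DD_ne hne]
    have : Complex.sin (Real.pi * (-(n:ℂ) + m)) = 0 := by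
      rw [Complex.sin_eq_zero_iff]
      exact ⟨-n + m, by push_cast; ring⟩
    rw [this]; simp

/-- There is an entire function `G` which equals
`sin(πs)·Γ(s)·(h(s) − ζ(s+1) + (Γ′(s)/Γ(s))·ζ(s) + ζ′(s))` for `Re(s) > 1`, where
`h(s) = Σ_{n=1}^∞ H_n n^{−s}`, and satisfies `G(1 − n) = π·A_n` for every integer `n ≥ 1`. -/
theorem exists_entire_F :
    ∃ G : ℂ → ℂ, Differentiable ℂ G ∧
      (∀ s : ℂ, 1 < s.re →
        G s = Complex.sin (Real.pi * s) * Complex.Gamma s *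
          ((∑' n : ℕ, ((harmonic (n + 1) : ℚ) : ℂ) * ((n + 1 : ℕ) : ℂ) ^ (-s))
            - riemannZeta (s + 1)
            + (deriv Complex.Gamma s / Complex.Gamma s) * riemannZeta s
            + deriv riemannZeta s)) ∧
      (∀ n : ℕ, 1 ≤ n → G (1 - (n : ℂ)) = (Real.pi : ℂ) * convA n) := by
  refine ⟨fun s => (1/2:ℂ) ^ s * SS s + Complex.sin (Real.pi * s) * mellin tailFn s, ?_, ?_, ?_⟩
  · have h1 := SS_diff
    have h2 := tail_diff
    have h3 : Differentiable ℂ fun s : ℂ => (1/2:ℂ) ^ s := fun s =>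
      (hasDerivAt_id s).const_cpow (Or.inl (by norm_num)) |>.differentiableAt
    have h4 : Differentiable ℂ fun s : ℂ => Complex.sin (Real.pi * s) :=
      fun z => (sinpi_hasDeriv z).differentiableAt
    exact (h3.mul h1).add (h4.mul h2)
  · intro s hs
    rw [mul_assoc, ← mellin_phi_eq hs, mellin_phi_split hs]
    simp only []
    rw [SS_eq hs]
    ring
  · intro n hn
    obtain ⟨m, rfl⟩ := Nat.exists_eq_add_of_le' hn
    simp only []
    rw [sin_int_zero, zero_mul, add_zero]
    have e : (1:ℂ) - ((m + 1 : ℕ) : ℂ) = -(m:ℂ) := by push_cast; ring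
    rw [e, SS_val, Complex.cpow_neg, Complex.cpow_natCast]
    have : ((1/2:ℂ)) ^ m ≠ 0 := pow_ne_zero _ (by norm_num)
    field_simp
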